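/- Let (K, v) be a discretely valued field with valuation ring O_K and residue field k, and assume char(K) ≠ 3 and char(k) ≠ 3. Let F ∈ K[x] be a separable polynomial of degree 4. Then there exist α, β, η ∈ K with α ≠ 0 and η ≠ 0, an element c ∈ K with 0 ≤ v(c) ≤ 2, and a monic separable quartic f₀ ∈ K[x] satisfying the reducedness conditions — all coefficients of f₀ in O_K, λ(f₀) < 1, and, in case λ(f₀) = 0, the image of f₀ in k[x] is not the fourth power of a monic linear polynomial — such that F(α·x + β) = c·η³·f₀(x) as polynomials in K[x]. (This is the polynomial content of the fact that every nonspecial Picard curve y³ = F(x) admits a reduced short Weierstrass equation y³ = c·f₀(x).) -/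

import Mathlib

open Polynomial

namespace AddValuation

variable {K : Type*} [Field K] (v : AddValuation K (WithTop ℤ))

/-- The subring of elements of nonnegative valuation. -/
def integerSubring : Subring K where
  carrier := {x | 0 ≤ v x}
  mul_mem' {a b} ha hb := by
    simp only [Set.mem_ofPred_eq, v.map_mul] at *
    exact add_nonneg ha hb
  one_mem' := by simp
  add_mem' {a b} ha hb := v.map_le_add ha hb
  zero_mem' := by simp
  neg_mem' {a} ha := by simpa [v.map_neg] using ha

variable {v}

theorem mem_integerSubring {x : K} : x ∈ v.integerSubring ↔ 0 ≤ v x := Iff.rfl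

theorem exists_eq_coe {x : K} (hx : x ≠ 0) : ∃ n : ℤ, v x = n := by
  obtain ⟨n, hn⟩ := WithTop.ne_top_iff_exists.mp (v.ne_top_iff.mpr hx)
  exact ⟨n, hn.symm⟩

theorem ne_zero_of_eq_coe {x : K} {n : ℤ} (hx : v x = n) : x ≠ 0 := by
  rintro rfl
  simp at hx

theorem div_mem_integerSubring {x y : K} (hy : y ≠ 0) (h : v y ≤ v x) :
    x / y ∈ v.integerSubring := by
  rw [mem_integerSubring]
  obtain ⟨n, hn⟩ := exists_eq_coe (v := v) hy
  have hxy : v x = v y + v (x / y) := by rw [← v.map_mul, mul_div_cancel₀ _ hy]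
  rw [hxy] at h
  rcases eq_or_ne (x / y) 0 with h0 | h0
  · simp [h0]
  obtain ⟨m, hm⟩ := exists_eq_coe (v := v) h0
  rw [hn, hm] at h
  rw [hm]
  norm_cast at *
  omega

theorem exists_le_coeff (p : K[X]) : ∃ m : ℤ, ∀ n, (m : WithTop ℤ) ≤ v (p.coeff n) := by
  induction p using Polynomial.induction_on' with
  | add p q hp hq =>
    obtain ⟨a, ha⟩ := hp
    obtain ⟨b, hb⟩ := hq
    refine ⟨min a b, fun n => ?_⟩
    rw [coeff_add]
    refine v.map_le_add (le_trans ?_ (ha n)) (le_trans ?_ (hb n)) <;> norm_cast <;> simp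
  | monomial k a =>
    rcases eq_or_ne a 0 with rfl | ha
    · exact ⟨0, by simp⟩
    obtain ⟨m, hm⟩ := exists_eq_coe (v := v) ha
    refine ⟨m, fun n => ?_⟩
    rw [coeff_monomial]
    split_ifs <;> simp [hm]

theorem exists_C_mul_coeff_mem (hsurj : ∀ n : ℤ, ∃ x : K, v x = (n : WithTop ℤ)) (p q : K[X]) :
    ∃ γ ∈ v.integerSubring, γ ≠ 0 ∧ (∀ n, γ * p.coeff n ∈ v.integerSubring) ∧
      ∀ n, γ * q.coeff n ∈ v.integerSubring := by
  obtain ⟨a, ha⟩ := exists_le_coeff (v := v) p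
  obtain ⟨b, hb⟩ := exists_le_coeff (v := v) q
  obtain ⟨γ, hγ⟩ := hsurj (max 0 (max (-a) (-b)))
  refine ⟨γ, ?_, ne_zero_of_eq_coe hγ, fun n => ?_, fun n => ?_⟩
  · rw [mem_integerSubring, hγ]
    norm_cast
    simp
  · rw [mem_integerSubring, v.map_mul, hγ]
    refine le_trans ?_ (add_le_add_right (ha n) _)
    norm_cast
    omega
  · rw [mem_integerSubring, v.map_mul, hγ]
    refine le_trans ?_ (add_le_add_right (hb n) _)
    norm_cast
    omega

theorem eval_mem_integerSubring {p : K[X]} (hp : ∀ n, p.coeff n ∈ v.integerSubring) {x : K}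
    (hx : x ∈ v.integerSubring) : p.eval x ∈ v.integerSubring := by
  rw [eval_eq_sum_range]
  exact sum_mem fun i _ => mul_mem (hp i) (pow_mem hx i)

theorem mem_integerSubring_of_eval_mem {p : K[X]} (hm : p.Monic) (hd : p.natDegree = 4)
    (hp : ∀ n, p.coeff n ∈ v.integerSubring) {x : K} (hx : p.eval x ∈ v.integerSubring) :
    x ∈ v.integerSubring := by
  by_contra hneg
  have hx0 : x ≠ 0 := by rintro rfl; exact hneg (zero_mem _)
  obtain ⟨n, hn⟩ := exists_eq_coe (v := v) hx0
  rw [mem_integerSubring, hn] at hneg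
  have h4 : p.coeff 4 = 1 := hd ▸ hm
  have hsum : v x + v x⁻¹ = 0 := by rw [← v.map_mul, mul_inv_cancel₀ hx0, v.map_one]
  obtain ⟨m, hm'⟩ := exists_eq_coe (v := v) (inv_ne_zero hx0)
  rw [hn, hm'] at hsum
  norm_cast at hsum hneg
  have ht : x⁻¹ ∈ v.integerSubring := by
    rw [mem_integerSubring, hm']
    norm_cast
    omega
  have hmem : x⁻¹ ^ 3 * p.eval x - p.coeff 3 - p.coeff 2 * x⁻¹ - p.coeff 1 * x⁻¹ ^ 2
      - p.coeff 0 * x⁻¹ ^ 3 ∈ v.integerSubring :=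
    sub_mem (sub_mem (sub_mem (sub_mem (mul_mem (pow_mem ht 3) hx) (hp 3)) (mul_mem (hp 2) ht))
      (mul_mem (hp 1) (pow_mem ht 2))) (mul_mem (hp 0) (pow_mem ht 3))
  have heq : x = x⁻¹ ^ 3 * p.eval x - p.coeff 3 - p.coeff 2 * x⁻¹ - p.coeff 1 * x⁻¹ ^ 2
      - p.coeff 0 * x⁻¹ ^ 3 := by
    rw [eval_eq_sum_range, hd]
    simp only [Finset.sum_range_succ, Finset.sum_range_zero, h4]
    field_simp
    ring
  rw [← heq, mem_integerSubring, hn] at hmem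
  norm_cast at hmem

end AddValuation

namespace Polynomial

variable {K : Type*} [Field K]

/-- The quartic `α⁻⁴ f(αx + β)`. -/
noncomputable def quarticTransform (f : K[X]) (α β : K) : K[X] :=
  C (α⁻¹ ^ 4) * f.comp (C α * X + C β)

variable {f : K[X]} {α β : K}

theorem comp_eq_quarticTransform (hα : α ≠ 0) :
    f.comp (C α * X + C β) = C (α ^ 4) * f.quarticTransform α β := by
  rw [quarticTransform, ← mul_assoc, ← C_mul, ← mul_pow, mul_inv_cancel₀ hα]
  simp

theorem quarticTransform_quarticTransform (γ δ : K) :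
    (f.quarticTransform α β).quarticTransform γ δ =
      f.quarticTransform (α * γ) (α * δ + β) := by
  simp only [quarticTransform, mul_comp, C_comp, comp_assoc, add_comp, X_comp, mul_inv, mul_pow,
    map_mul, map_add]
  rw [show C α * (C γ * X + C δ) + C β = C α * C γ * X + (C α * C δ + C β) by ring]
  ring

theorem quarticTransform_one_zero : f.quarticTransform 1 0 = f := by
  simp [quarticTransform]

theorem quarticTransform_one (a : K) : f.quarticTransform 1 a = f.comp (X + C a) := by
  simp [quarticTransform]

theorem natDegree_quarticTransform (hα : α ≠ 0) :
    (f.quarticTransform α β).natDegree = f.natDegree := by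
  rw [quarticTransform, natDegree_C_mul (pow_ne_zero 4 (inv_ne_zero hα)), natDegree_comp,
    natDegree_linear hα, mul_one]

theorem Monic.quarticTransform (hm : f.Monic) (hd : f.natDegree = 4) (hα : α ≠ 0) :
    (f.quarticTransform α β).Monic := by
  rw [Monic, Polynomial.quarticTransform, leadingCoeff_mul, leadingCoeff_C, leadingCoeff_comp
    (by rw [natDegree_linear hα]; simp), hm.leadingCoeff, hd, leadingCoeff_linear hα, one_mul,
    ← mul_pow, inv_mul_cancel₀ hα, one_pow]

theorem Separable.quarticTransform (hf : f.Separable) (hα : α ≠ 0) :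
    (f.quarticTransform α β).Separable := by
  obtain ⟨a, b, hab⟩ := hf
  have hα' : C α * C α⁻¹ = (1 : K[X]) := by rw [← C_mul, mul_inv_cancel₀ hα, C_1]
  have h := congrArg (fun p => p.comp (C α * X + C β)) hab
  simp only [add_comp, mul_comp, one_comp] at h
  refine ⟨C (α ^ 4) * a.comp (C α * X + C β), C (α ^ 3) * b.comp (C α * X + C β), ?_⟩
  rw [Polynomial.quarticTransform, derivative_C_mul, derivative_comp, derivative_add,
    derivative_C_mul, derivative_X, derivative_C]
  simp only [map_pow]
  linear_combination h + (a.comp (C α * X + C β) * f.comp (C α * X + C β)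
    + b.comp (C α * X + C β) * f.derivative.comp (C α * X + C β)) *
    ((C α * C α⁻¹) ^ 3 + (C α * C α⁻¹) ^ 2 + C α * C α⁻¹ + 1) * hα'

theorem coeff_quarticTransform_zero (n : ℕ) :
    (f.quarticTransform α 0).coeff n = α⁻¹ ^ 4 * (f.coeff n * α ^ n) := by
  simp [quarticTransform, comp_C_mul_X_coeff]

theorem eval_eq_quarticTransform (hα : α ≠ 0) :
    f.eval β = α ^ 4 * (f.quarticTransform α β).eval 0 := by
  have h := congrArg (eval 0) (comp_eq_quarticTransform (f := f) (β := β) hα)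
  simpa [eval_comp] using h

theorem eval_derivative_eq_quarticTransform (hα : α ≠ 0) :
    f.derivative.eval β = α ^ 3 * (f.quarticTransform α β).derivative.eval 0 := by
  have h := congrArg (fun p => eval 0 (derivative p))
    (comp_eq_quarticTransform (f := f) (β := β) hα)
  simp only [derivative_C_mul, derivative_comp, eval_comp, derivative_add, derivative_X,
    derivative_C, eval_add, eval_mul, eval_C, eval_X, mul_one, mul_zero,
    zero_add, add_zero] at h
  apply mul_left_cancel₀ hα
  rw [h]
  ring

end Polynomial

namespace AddValuation

variable {K : Type*} [Field K] {v : AddValuation K (WithTop ℤ)} {f : K[X]}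

theorem exists_quarticTransform_coeff_mem (hsurj : ∀ n : ℤ, ∃ x : K, v x = (n : WithTop ℤ))
    (hm : f.Monic) (hd : f.natDegree = 4) :
    ∃ α : K, α ≠ 0 ∧ ∀ n, (f.quarticTransform α 0).coeff n ∈ v.integerSubring := by
  obtain ⟨γ, hγ, hγ0, h, -⟩ := exists_C_mul_coeff_mem hsurj f 0
  refine ⟨γ⁻¹, inv_ne_zero hγ0, fun n => ?_⟩
  rw [coeff_quarticTransform_zero, inv_inv]
  rcases lt_trichotomy n 4 with hn | rfl | hn
  · have : γ ^ 4 * (f.coeff n * γ⁻¹ ^ n) = γ ^ (3 - n) * (γ * f.coeff n) := by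
      interval_cases n <;> norm_num <;> field_simp
    rw [this]
    exact mul_mem (pow_mem hγ _) (h n)
  · have h4 : f.coeff 4 = 1 := hd ▸ hm
    rw [h4, one_mul, ← mul_pow, mul_inv_cancel₀ hγ0, one_pow]
    exact one_mem _
  · rw [coeff_eq_zero_of_natDegree_lt (hd ▸ hn)]
    simp [zero_mem]

theorem exists_bound_quarticTransform (hsurj : ∀ n : ℤ, ∃ x : K, v x = (n : WithTop ℤ))
    (hm : f.Monic) (hd : f.natDegree = 4) (hsep : f.Separable)
    (hf : ∀ n, f.coeff n ∈ v.integerSubring) :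
    ∃ b : ℤ, ∀ (n : ℤ) (α β : K), v α = n →
      (∀ i, (f.quarticTransform α β).coeff i ∈ v.integerSubring) → n ≤ b := by
  obtain ⟨p, q, hpq⟩ := hsep
  obtain ⟨γ, hγ, hγ0, hp, hq⟩ := exists_C_mul_coeff_mem hsurj p q
  obtain ⟨b, hb⟩ := exists_eq_coe (v := v) hγ0
  refine ⟨b, fun n α β hα hInt => ?_⟩
  have hb0 : 0 ≤ b := by
    rw [mem_integerSubring, hb] at hγ
    exact_mod_cast hγ
  rcases lt_or_ge n 0 with hn | hn
  · omega
  have hα0 : α ≠ 0 := ne_zero_of_eq_coe hα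
  have hαO : α ∈ v.integerSubring := by
    rw [mem_integerSubring, hα]
    exact_mod_cast hn
  have hg0 := eval_mem_integerSubring hInt (zero_mem _)
  have hg1 : (f.quarticTransform α β).derivative.eval 0 ∈ v.integerSubring := by
    refine eval_mem_integerSubring (fun i => ?_) (zero_mem _)
    rw [coeff_derivative]
    exact mul_mem (hInt _) (add_mem (natCast_mem _ i) (one_mem _))
  have hβ : β ∈ v.integerSubring := by
    refine mem_integerSubring_of_eval_mem hm hd hf ?_
    rw [eval_eq_quarticTransform hα0]
    exact mul_mem (pow_mem hαO 4) hg0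
  have hP : (C γ * p).eval β ∈ v.integerSubring :=
    eval_mem_integerSubring (by simpa using hp) hβ
  have hQ : (C γ * q).eval β ∈ v.integerSubring :=
    eval_mem_integerSubring (by simpa using hq) hβ
  have key : γ = α * (α ^ 2 * (α * ((C γ * p).eval β * (f.quarticTransform α β).eval 0)
      + (C γ * q).eval β * (f.quarticTransform α β).derivative.eval 0)) := by
    have h := congrArg (eval β) hpq
    simp only [eval_add, eval_mul, eval_one, eval_eq_quarticTransform (f := f) (β := β) hα0,
      eval_derivative_eq_quarticTransform (f := f) (β := β) hα0] at h
    simp only [eval_mul, eval_C]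
    linear_combination (-γ) * h
  have hmem : 0 ≤ v (α ^ 2 * (α * ((C γ * p).eval β * (f.quarticTransform α β).eval 0)
      + (C γ * q).eval β * (f.quarticTransform α β).derivative.eval 0)) :=
    mem_integerSubring.mp <| mul_mem (pow_mem hαO 2)
      (add_mem (mul_mem hαO (mul_mem hP hg0)) (mul_mem hQ hg1))
  have hle : v α ≤ v γ := by
    conv_rhs => rw [key, v.map_mul]
    exact le_add_of_nonneg_right hmem
  rw [hα, hb] at hle
  exact_mod_cast hle

theorem quarticTransform_coeff_mem_of_le (hm : f.Monic) (hd : f.natDegree = 4)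
    {π : K} (hπ : v π = 1) (h3 : 1 ≤ v (f.coeff 3)) (h2 : 2 ≤ v (f.coeff 2))
    (h1 : 3 ≤ v (f.coeff 1)) (h0 : 4 ≤ v (f.coeff 0)) (n : ℕ) :
    (f.quarticTransform π 0).coeff n ∈ v.integerSubring := by
  have hπ0 : π ≠ 0 := ne_zero_of_eq_coe (n := 1) (by simpa using hπ)
  rw [coeff_quarticTransform_zero]
  have hpow : ∀ k : ℕ, v (π ^ k) = k := fun k => by simp [v.map_pow, hπ]
  rcases lt_trichotomy n 4 with hn | rfl | hn
  · have : π⁻¹ ^ 4 * (f.coeff n * π ^ n) = f.coeff n / π ^ (4 - n) := by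
      interval_cases n <;> norm_num <;> field_simp
    rw [this]
    refine div_mem_integerSubring (pow_ne_zero _ hπ0) ?_
    rw [hpow]
    interval_cases n <;> simpa
  · have h4 : f.coeff 4 = 1 := hd ▸ hm
    rw [h4, one_mul, ← mul_pow, inv_mul_cancel₀ hπ0, one_pow]
    exact one_mem _
  · rw [coeff_eq_zero_of_natDegree_lt (hd ▸ hn)]
    simp [zero_mem]

theorem comp_X_add_C_coeff_mem (hf : ∀ n, f.coeff n ∈ v.integerSubring) {a : K}
    (ha : a ∈ v.integerSubring) (n : ℕ) : (f.comp (X + C a)).coeff n ∈ v.integerSubring := by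
  have hlift : f ∈ lifts v.integerSubring.subtype := by
    rw [lifts_iff_coeff_lifts]
    exact fun n => ⟨⟨_, hf n⟩, rfl⟩
  obtain ⟨g, rfl⟩ := (mem_lifts _).mp hlift
  have : (g.map v.integerSubring.subtype).comp (X + C a) =
      (g.comp (X + C ⟨a, ha⟩)).map v.integerSubring.subtype := by
    simp [Polynomial.map_comp]
  rw [this, coeff_map]
  exact Subtype.property _

/-- Among the integral transforms of `f`, one with `v α` maximal can be chosen reduced. -/
theorem exists_reduced_quarticTransform (hsurj : ∀ n : ℤ, ∃ x : K, v x = (n : WithTop ℤ))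
    (hm : f.Monic) (hd : f.natDegree = 4) (hsep : f.Separable)
    (hf : ∀ n, f.coeff n ∈ v.integerSubring) :
    ∃ (α β : K) (g : K[X]), α ≠ 0 ∧ g = f.quarticTransform α β ∧
      (∀ n : ℕ, 0 ≤ v (g.coeff n)) ∧
      (v (g.coeff 3) < 1 ∨ v (g.coeff 2) < 2 ∨ v (g.coeff 1) < 3 ∨ v (g.coeff 0) < 4) ∧
      ((v (g.coeff 3) = 0 ∨ v (g.coeff 2) = 0 ∨ v (g.coeff 1) = 0 ∨ v (g.coeff 0) = 0) →
        ¬ ∃ a : K, 0 ≤ v a ∧ ∀ n : ℕ, 0 < v ((g.comp (X + C a) - X ^ 4).coeff n)) := by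
  obtain ⟨b, hb⟩ := exists_bound_quarticTransform hsurj hm hd hsep hf
  obtain ⟨n, ⟨α, β, hα, hInt⟩, hmax⟩ := Int.exists_greatest_of_bdd
    (P := fun n : ℤ => ∃ α β : K, v α = n ∧
      ∀ i, (f.quarticTransform α β).coeff i ∈ v.integerSubring)
    ⟨b, fun n ⟨α, β, hα, h⟩ => hb n α β hα h⟩
    ⟨0, 1, 0, by simp, by rwa [quarticTransform_one_zero]⟩
  obtain ⟨π, hπ⟩ := hsurj 1
  have hα0 : α ≠ 0 := ne_zero_of_eq_coe hα
  have hlam : ∀ β : K,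
      v ((f.quarticTransform α β).coeff 3) < 1 ∨ v ((f.quarticTransform α β).coeff 2) < 2 ∨
      v ((f.quarticTransform α β).coeff 1) < 3 ∨ v ((f.quarticTransform α β).coeff 0) < 4 := by
    intro β
    by_contra! hcon
    obtain ⟨h3, h2, h1, h0⟩ := hcon
    have h := quarticTransform_coeff_mem_of_le (hm.quarticTransform hd hα0)
      ((natDegree_quarticTransform hα0).trans hd) (by simpa using hπ) h3 h2 h1 h0
    simp only [quarticTransform_quarticTransform] at h
    have := hmax (n + 1) ⟨α * π, _, by rw [v.map_mul, hα, hπ]; norm_cast, h⟩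
    omega
  by_cases hbad : ∃ a : K, 0 ≤ v a ∧
      ∀ n : ℕ, 0 < v (((f.quarticTransform α β).comp (X + C a) - X ^ 4).coeff n)
  · obtain ⟨a, ha, hpos⟩ := hbad
    have hshift : (f.quarticTransform α β).comp (X + C a) =
        f.quarticTransform α (α * a + β) := by
      rw [← quarticTransform_one, quarticTransform_quarticTransform, mul_one]
    have hInt' := comp_X_add_C_coeff_mem hInt (a := a) ha
    rw [hshift] at hpos hInt'
    refine ⟨α, α * a + β, _, hα0, rfl, hInt', hlam _, fun h => absurd h ?_⟩
    have hne : ∀ i, i < 4 → v ((f.quarticTransform α (α * a + β)).coeff i) ≠ 0 := by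
      intro i hi
      have := hpos i
      rw [coeff_sub, coeff_X_pow, if_neg hi.ne, sub_zero] at this
      exact this.ne'
    simp [hne]
  · exact ⟨α, β, _, hα0, rfl, hInt, hlam β, fun _ => hbad⟩

theorem exists_eq_mul_cube (hsurj : ∀ n : ℤ, ∃ x : K, v x = (n : WithTop ℤ)) {x : K}
    (hx : x ≠ 0) : ∃ c η : K, η ≠ 0 ∧ 0 ≤ v c ∧ v c ≤ 2 ∧ x = c * η ^ 3 := by
  obtain ⟨m, hm⟩ := exists_eq_coe (v := v) hx
  obtain ⟨η, hη⟩ := hsurj (m / 3)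
  have hη0 : η ≠ 0 := ne_zero_of_eq_coe hη
  have hxc : x = x / η ^ 3 * η ^ 3 := by field_simp
  obtain ⟨r, hr⟩ := exists_eq_coe (v := v) (div_ne_zero hx (pow_ne_zero 3 hη0))
  have hv := congrArg v hxc
  rw [v.map_mul, v.map_pow, hr, hη, hm] at hv
  norm_cast at hv
  rw [nsmul_eq_mul] at hv
  push_cast at hv
  refine ⟨x / η ^ 3, η, hη0, ?_, ?_, hxc⟩ <;> rw [hr]
  · have : 0 ≤ r := by omega
    exact_mod_cast this
  · have : r ≤ 2 := by omega
    exact WithTop.coe_le_coe.mpr this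

end AddValuation

/-- Every separable quartic `F` over a discretely valued field `(K, v)` with residue
characteristic `≠ 3` and `char K ≠ 3` can be transformed, by a substitution
`x ↦ αx + β` and extraction of a cube `η³` and a factor `c` with `0 ≤ v(c) ≤ 2`, into a
reduced monic quartic `f₀`: this is the polynomial content of the reduced short
Weierstrass equation `y³ = c·f₀(x)` for the Picard curve `y³ = F(x)`. -/
theorem exists_reduced_short_weierstrass
    {K : Type*} [Field K] (v : AddValuation K (WithTop ℤ))
    (hsurj : ∀ n : ℤ, ∃ x : K, v x = (n : WithTop ℤ))
    (h3K : (3 : K) ≠ 0) (h3k : v (3 : K) = 0)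
    (F : K[X]) (hdeg : F.natDegree = 4) (hsep : F.Separable) :
    ∃ (α β η c : K) (f₀ : K[X]), α ≠ 0 ∧ η ≠ 0 ∧
      0 ≤ v c ∧ v c ≤ 2 ∧
      f₀.Monic ∧ f₀.natDegree = 4 ∧ f₀.Separable ∧
      (∀ n : ℕ, 0 ≤ v (f₀.coeff n)) ∧
      (v (f₀.coeff 3) < 1 ∨ v (f₀.coeff 2) < 2 ∨ v (f₀.coeff 1) < 3 ∨ v (f₀.coeff 0) < 4) ∧
      ((v (f₀.coeff 3) = 0 ∨ v (f₀.coeff 2) = 0 ∨ v (f₀.coeff 1) = 0 ∨ v (f₀.coeff 0) = 0) →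
        ¬ ∃ a : K, 0 ≤ v a ∧ ∀ n : ℕ, 0 < v ((f₀.comp (X + C a) - X ^ 4).coeff n)) ∧
      F.comp (C α * X + C β) = C (c * η ^ 3) * f₀ := by
  have hF : F.leadingCoeff ≠ 0 := by
    rw [Ne, leadingCoeff_eq_zero]
    rintro rfl
    simp at hdeg
  set A := F.leadingCoeff with hA
  have hFA : F = C A * (C A⁻¹ * F) := by
    rw [← mul_assoc, ← C_mul, mul_inv_cancel₀ hF, C_1, one_mul]
  have hm : (C A⁻¹ * F).Monic := by
    rw [Monic, leadingCoeff_mul, leadingCoeff_C, ← hA, inv_mul_cancel₀ hF]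
  have hd : (C A⁻¹ * F).natDegree = 4 := by
    rw [natDegree_C_mul (inv_ne_zero hF), hdeg]
  have hs : (C A⁻¹ * F).Separable :=
    hsep.unit_mul (isUnit_C.mpr (inv_ne_zero hF).isUnit)
  obtain ⟨α₀, hα₀, hInt⟩ := AddValuation.exists_quarticTransform_coeff_mem hsurj hm hd
  obtain ⟨α, β, g, hα, rfl, hg, hlam, hred⟩ :=
    AddValuation.exists_reduced_quarticTransform hsurj (hm.quarticTransform hd hα₀)
      ((natDegree_quarticTransform hα₀).trans hd) (hs.quarticTransform hα₀) hInt
  rw [quarticTransform_quarticTransform] at hg hlam hred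
  have hαα : α₀ * α ≠ 0 := mul_ne_zero hα₀ hα
  obtain ⟨c, η, hη, hc0, hc2, hc⟩ :=
    AddValuation.exists_eq_mul_cube hsurj (mul_ne_zero hF (pow_ne_zero 4 hαα))
  refine ⟨α₀ * α, α₀ * β + 0, η, c, _, hαα, hη, hc0, hc2, hm.quarticTransform hd hαα,
    (natDegree_quarticTransform hαα).trans hd, hs.quarticTransform hαα, hg, hlam, hred, ?_⟩
  rw [← hc, C_mul (a := A), mul_assoc, ← comp_eq_quarticTransform hαα]
  conv_lhs => rw [hFA, mul_comp, C_comp]
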